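/- Fix c ∈ {6, 7} and ε > 0. There exists a constant C > 0 such that for every sufficiently large integer n, the number N_c of 8-tuples (x1, x2, y1, y2, z1, z2, z3, z4) of positive integers satisfying x1^2 − x2^2 = y1^c − y2^c + z1^5 + z2^5 − z3^5 − z4^5, with P_2/2 < x1, x2 ≤ P_2, P_c/2 < y_i ≤ P_c for i = 1, 2 and 1 ≤ z_j ≤ P_5^{θ_c} for j = 1, 2, 3, 4, satisfies N_c ≤ C · P_2^{1+ε} · P_c · P_5^{2θ_c}. -/

import Mathlib

open MeasureTheory Finset

noncomputable section

/-- `e(x) = exp(2πix)`. -/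
def e (x : ℝ) : ℂ := Complex.exp (2 * Real.pi * Complex.I * x)

/-- `P_k = n^(1/k)`. -/
def P (n k : ℕ) : ℝ := (n : ℝ) ^ ((k : ℝ))⁻¹

/-- `θ_6 = 5/6`, `θ_7 = 87/98`. -/
def θ (c : ℕ) : ℝ := if c = 6 then 5 / 6 else 87 / 98

/-- `Θ_c = 2/3 + θ_c/5 + 1/6 + 1/c`. -/
def Θ (c : ℕ) : ℝ := 2 / 3 + θ c / 5 + 1 / 6 + ((c : ℝ))⁻¹

/-- `f_k(α) = Σ_{P_k/2 < p ≤ P_k, p prime} e(α p^k) log p`. -/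
def f (n k : ℕ) (α : ℝ) : ℂ :=
  ∑ p ∈ (Finset.range (n + 1)).filter
      (fun p : ℕ => p.Prime ∧ P n k / 2 < (p : ℝ) ∧ (p : ℝ) ≤ P n k),
    e (α * (p : ℝ) ^ k) * (Real.log p)

/-- `f_{5,c}(α) = Σ_{1 < p ≤ P_5^{θ_c}, p prime} e(α p^5) log p`. -/
def f5 (n c : ℕ) (α : ℝ) : ℂ :=
  ∑ p ∈ (Finset.range (n + 1)).filter
      (fun p : ℕ => p.Prime ∧ 1 < (p : ℝ) ∧ (p : ℝ) ≤ P n 5 ^ θ c),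
    e (α * (p : ℝ) ^ 5) * (Real.log p)

/-- `F_c(α) = f_2(α)^2 f_3(α)^2 f_{5,c}(α) f_6(α) f_c(α)`. -/
def F (n c : ℕ) (α : ℝ) : ℂ :=
  f n 2 α ^ 2 * f n 3 α ^ 2 * f5 n c α * f n 6 α * f n c α

/-- `S_k(q,a) = Σ_{x=1,(x,q)=1}^{q} e(a x^k / q)`. -/
def S (k q a : ℕ) : ℂ :=
  ∑ x ∈ (Finset.Icc 1 q).filter (fun x => Nat.gcd x q = 1),
    e ((a : ℝ) * (x : ℝ) ^ k / q)

/-- `v_k(β) = (1/k) Σ_{2^{-k} n < m ≤ n} m^{1/k-1} e(β m)`. -/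
def v (n k : ℕ) (β : ℝ) : ℂ :=
  ((k : ℂ))⁻¹ *
    ∑ m ∈ (Finset.Icc 1 n).filter (fun m : ℕ => (n : ℝ) / 2 ^ k < (m : ℝ)),
      ((m : ℝ) ^ ((k : ℝ)⁻¹ - 1) : ℝ) * e (β * m)

/-- `w_c(β) = v_2(β)^2 v_3(β)^2 v_6(β) v_c(β)`. -/
def w (n c : ℕ) (β : ℝ) : ℂ := v n 2 β ^ 2 * v n 3 β ^ 2 * v n 6 β * v n c β

/-- `U_c(q,a) = S_2(q,a)^2 S_3(q,a)^2 S_5(q,a) S_6(q,a) S_c(q,a)`. -/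
def U (c q a : ℕ) : ℂ := S 2 q a ^ 2 * S 3 q a ^ 2 * S 5 q a * S 6 q a * S c q a

/-- `A_{n,c}(q) = Σ_{a=1,(a,q)=1}^{q} U_c(q,a) e(-a n / q)`. -/
def A (n : ℤ) (c q : ℕ) : ℂ :=
  ∑ a ∈ (Finset.Icc 1 q).filter (fun a => Nat.gcd a q = 1),
    U c q a * e (-((a : ℝ) * (n : ℝ)) / q)

/-- The major arcs `𝔐`. -/
def Maj (n : ℕ) (B : ℝ) : Set ℝ :=
  {α | α ∈ Set.Icc (0 : ℝ) 1 ∧ ∃ a q : ℕ, a ≤ q ∧ 1 ≤ q ∧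
    (q : ℝ) ≤ Real.log n ^ B ∧ Nat.gcd a q = 1 ∧
    |α - (a : ℝ) / q| ≤ Real.log n ^ B / n}

/-- `Q_c = n^{2/(3c²(c-1))}`. -/
def Q (n c : ℕ) : ℝ := (n : ℝ) ^ (2 / (3 * (c : ℝ) ^ 2 * ((c : ℝ) - 1)))

/-- The arcs `𝕽_c`. -/
def R (n c : ℕ) : Set ℝ :=
  {α | α ∈ Set.Icc (0 : ℝ) 1 ∧ ∃ a q : ℕ, a ≤ q ∧ 1 ≤ q ∧
    (q : ℝ) ≤ Q n c ∧ Nat.gcd a q = 1 ∧ |(q : ℝ) * α - a| ≤ Q n c / n}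

/-- `τ = 2^{-20}`. -/
def τ : ℝ := ((2 : ℝ) ^ (20 : ℕ))⁻¹

/-- The sets `𝓔_c`. -/
def E (n c : ℕ) : Set ℝ :=
  {α | α ∈ Set.Icc (0 : ℝ) 1 ∧
    ‖f n c α‖ ≤ P n c ^ (if c = 6 then 1 - 24 * τ else 139 / 140 - 24 * τ)}

end


theorem div_bound (δ : ℝ) (hδ : 0 < δ) :
    ∃ C : ℝ, 0 < C ∧ ∀ m : ℕ, 0 < m → (#m.divisors : ℝ) ≤ C * (m : ℝ) ^ δ := by
  set a : ℝ := (2 : ℝ) ^ δ - 1 with ha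
  have ha0 : 0 < a := by
    have : (1 : ℝ) < 2 ^ δ := Real.one_lt_rpow (by norm_num) hδ
    linarith
  set K : ℝ := 1 + 1 / a with hK
  have hK1 : 1 ≤ K := by
    have : 0 < 1 / a := by positivity
    linarith
  have hv : ∀ v : ℕ, ((v : ℝ) + 1) ≤ K * ((2 : ℝ) ^ δ) ^ v := by
    intro v
    have h1 : 1 + (v : ℝ) * a ≤ (1 + a) ^ v := one_add_mul_le_pow (by linarith) v
    have h2 : (2 : ℝ) ^ δ = 1 + a := by rw [ha]; ring
    rw [h2]
    have h3 : K * (1 + (v : ℝ) * a) = 1 + v + v * a + 1 / a := by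
      rw [hK]; field_simp; ring
    have h4 : 0 < 1 / a := by positivity
    have h5 : 0 ≤ v * a := by positivity
    have := mul_le_mul_of_nonneg_left h1 (by linarith : (0 : ℝ) ≤ K)
    linarith
  obtain ⟨B, hB⟩ := exists_nat_ge ((2 : ℝ) ^ (1 / δ))
  refine ⟨K ^ B, by positivity, fun m hm => ?_⟩
  rw [Nat.card_divisors hm.ne']
  have hm2 : (m : ℝ) ^ δ = ∏ p ∈ m.primeFactors, ((p : ℝ) ^ δ) ^ (m.factorization p) := by
    conv_lhs => rw [← Nat.prod_factorization_pow_eq_self hm.ne']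
    rw [Finsupp.prod, Nat.support_factorization]
    push_cast
    rw [← Real.finsetProd_rpow _ _ (fun i _ => by positivity)]
    refine Finset.prod_congr rfl fun p _ => ?_
    rw [← Real.rpow_natCast, ← Real.rpow_natCast, ← Real.rpow_mul (by positivity),
      ← Real.rpow_mul (by positivity), mul_comm]
  rw [hm2]
  push_cast
  have step : ∏ p ∈ m.primeFactors, ((m.factorization p : ℝ) + 1) ≤
      ∏ p ∈ m.primeFactors, ((if p < B then K else 1) * ((p : ℝ) ^ δ) ^ (m.factorization p)) := by
    refine Finset.prod_le_prod (fun i _ => by positivity) fun p hp => ?_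
    have hp2 : (2 : ℝ) ≤ p := by exact_mod_cast (Nat.prime_of_mem_primeFactors hp).two_le
    split_ifs with h
    · refine (hv _).trans ?_
      gcongr
    · have : (2 : ℝ) ≤ (p : ℝ) ^ δ := by
        have h1 : (2 : ℝ) ^ (1 / δ) ≤ p := hB.trans (by exact_mod_cast not_lt.mp h)
        calc (2 : ℝ) = ((2 : ℝ) ^ (1 / δ)) ^ δ := by
              rw [← Real.rpow_mul (by norm_num)]; field_simp; simp
          _ ≤ _ := by gcongr
      rw [one_mul]
      calc ((m.factorization p : ℝ) + 1) ≤ 2 ^ (m.factorization p) := by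
            exact_mod_cast Nat.succ_le_of_lt (Nat.lt_two_pow_self)
        _ ≤ _ := by gcongr
  refine step.trans ?_
  rw [Finset.prod_mul_distrib]
  gcongr
  rw [Finset.prod_ite, Finset.prod_const, Finset.prod_const_one, mul_one]
  refine pow_le_pow_right₀ hK1 ?_
  calc #{x ∈ m.primeFactors | x < B} ≤ #(Finset.range B) := by
        apply Finset.card_le_card
        intro x hx
        simp at hx ⊢
        exact hx.2
    _ = B := by simp

/-- number of pairs with equal key -/
def En {α κ : Type*} [DecidableEq κ] (s : Finset α) (g : α → κ) : ℕ :=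
  #{x ∈ s ×ˢ s | g x.1 = g x.2}

theorem card_eq_key {α β κ : Type*} [DecidableEq κ] (s : Finset α) (t : Finset β)
    (g : α → κ) (k : β → κ) (M : Finset κ) (hM : ∀ a ∈ s, g a ∈ M) :
    #{x ∈ s ×ˢ t | g x.1 = k x.2} = ∑ m ∈ M, #{a ∈ s | g a = m} * #{b ∈ t | k b = m} := by
  rw [Finset.card_eq_sum_card_fiberwise (f := fun x => g x.1) (t := M)]
  · refine Finset.sum_congr rfl fun m _ => ?_
    rw [← Finset.card_product]
    congr 1
    ext x
    simp only [mem_filter, mem_product]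
    constructor
    · rintro ⟨⟨⟨h1, h2⟩, h3⟩, h4⟩
      exact ⟨⟨h1, h4⟩, h2, h3 ▸ h4⟩
    · rintro ⟨⟨h1, h4⟩, h2, h3⟩
      exact ⟨⟨⟨h1, h2⟩, h4.trans h3.symm⟩, h4⟩
  · intro x hx
    simp only [coe_filter, mem_product, Set.mem_ofPred_eq] at hx
    exact hM _ hx.1.1

theorem cs_key {α β κ : Type*} [DecidableEq κ] (s : Finset α) (t : Finset β)
    (g : α → κ) (k : β → κ) :
    (#{x ∈ s ×ˢ t | g x.1 = k x.2}) ^ 2 ≤ En s g * En t k := by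
  classical
  have hs : ∀ a ∈ s, g a ∈ s.image g ∪ t.image k := fun a ha =>
    mem_union_left _ (mem_image_of_mem _ ha)
  have ht : ∀ a ∈ t, k a ∈ s.image g ∪ t.image k := fun a ha =>
    mem_union_right _ (mem_image_of_mem _ ha)
  unfold En
  rw [card_eq_key s t g k _ hs, card_eq_key s s g g _ hs, card_eq_key t t k k _ ht]
  simp only [← sq]
  exact Finset.sum_mul_sq_le_sq_mul_sq _ _ _

theorem pig_key {α κ μ : Type*} [DecidableEq κ] [DecidableEq μ] (s : Finset α)
    (g : α → κ) (d : α → μ) (Ls : Finset μ) (hL : ∀ a ∈ s, d a ∈ Ls) :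
    En s g ≤ #Ls * En s (fun a => (g a, d a)) := by
  classical
  have hs : ∀ a ∈ s, g a ∈ s.image g := fun a ha => mem_image_of_mem _ ha
  have hs2 : ∀ a ∈ s, (g a, d a) ∈ (s.image g) ×ˢ Ls := fun a ha =>
    mem_product.2 ⟨hs a ha, hL a ha⟩
  unfold En
  rw [card_eq_key s s g g _ hs, card_eq_key s s (fun a => (g a, d a)) (fun a => (g a, d a)) _ hs2,
    sum_product, mul_sum]
  refine sum_le_sum fun m _ => ?_
  have : #{a ∈ s | g a = m} = ∑ l ∈ Ls, #{a ∈ s | (g a, d a) = (m, l)} := by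
    rw [Finset.card_eq_sum_card_fiberwise (f := d) (t := Ls)]
    · refine Finset.sum_congr rfl fun l _ => ?_
      rw [filter_filter]
      simp only [Prod.mk.injEq]
    · intro x hx
      simp only [coe_filter, Set.mem_ofPred_eq] at hx
      exact hL _ hx.1
  rw [this]
  simp only [← sq]
  exact sq_sum_le_card_mul_sum_sq

theorem fib_key {α β κ : Type*} [DecidableEq κ] (s : Finset α) (t : Finset β)
    (g : α → κ) (k : β → κ) (r : ℕ) (hr : ∀ m, #{b ∈ t | k b = m} ≤ r) :
    #{x ∈ s ×ˢ t | g x.1 = k x.2} ≤ #s * r := by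
  classical
  rw [card_eq_key s t g k (s.image g) fun a ha => mem_image_of_mem _ ha]
  calc _ ≤ ∑ m ∈ s.image g, #{a ∈ s | g a = m} * r := by
        gcongr; exact hr _
    _ = _ := by
        rw [← sum_mul, ← Finset.card_eq_sum_card_fiberwise]
        intro a ha; simpa using ⟨a, ha, rfl⟩

theorem fib_key' {α β κ : Type*} [DecidableEq κ] (s : Finset α) (t : Finset β)
    (g : α → κ) (k : β → κ) (r : ℕ) (hr : ∀ m, #{b ∈ s | g b = m} ≤ r) :
    #{x ∈ s ×ˢ t | g x.1 = k x.2} ≤ #t * r := by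
  refine le_trans (Finset.card_le_card_of_injOn (t := {x ∈ t ×ˢ s | k x.1 = g x.2}) Prod.swap ?_ ?_)
    (fib_key t s k g r hr)
  · intro x hx
    simp only [coe_filter, mem_product, Set.mem_ofPred_eq, Prod.fst_swap, Prod.snd_swap] at hx ⊢
    exact ⟨⟨hx.1.2, hx.1.1⟩, hx.2.symm⟩
  · exact Prod.swap_injective.injOn

def GG (k : ℕ) (x l t : ℤ) : ℤ := (x + l + t) ^ k - (x + l) ^ k - (x + t) ^ k + x ^ k

theorem GG_pos (k : ℕ) (hk : k = 5 ∨ k = 6 ∨ k = 7) (x l t : ℤ) (hx : 0 ≤ x) (hl : 0 < l)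
    (ht : 0 < t) : 0 < GG k x l t := by
  unfold GG
  rcases hk with rfl | rfl | rfl <;> ring_nf <;> positivity

theorem GG_lt (k : ℕ) (hk : k = 5 ∨ k = 6 ∨ k = 7) (x y l t : ℤ) (hx : 0 ≤ x) (hl : 0 < l)
    (ht : 0 < t) (hxy : x < y) : GG k x l t < GG k y l t := by
  obtain ⟨u, rfl⟩ : ∃ u, y = x + u := ⟨y - x, by ring⟩
  have hu : 0 < u := by linarith
  rw [← sub_pos]
  unfold GG
  rcases hk with rfl | rfl | rfl <;> ring_nf <;> positivity

theorem GG_inj_pos (k : ℕ) (hk : k = 5 ∨ k = 6 ∨ k = 7) (x y l t : ℤ) (hx : 0 ≤ x) (hy : 0 ≤ y)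
    (hl : 0 < l) (ht : 0 < t) (h : GG k x l t = GG k y l t) : x = y := by
  rcases lt_trichotomy x y with h1 | h1 | h1
  · exact absurd h (GG_lt k hk x y l t hx hl ht h1).ne
  · exact h1
  · exact absurd h (GG_lt k hk y x l t hy hl ht h1).ne'

theorem GG_negl (k : ℕ) (x l t : ℤ) : GG k (x + l) (-l) t = - GG k x l t := by
  unfold GG
  rw [show x + l + -l + t = x + t by ring, show x + l + -l = x by ring]
  ring

theorem GG_negt (k : ℕ) (x l t : ℤ) : GG k (x + t) l (-t) = - GG k x l t := by
  unfold GG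
  rw [show x + t + l + -t = x + l by ring, show x + t + -t = x by ring,
    show x + t + l = x + l + t by ring]
  ring

/-- all four corners are nonnegative -/
def Cor (x l t : ℤ) : Prop := 0 ≤ x ∧ 0 ≤ x + l ∧ 0 ≤ x + t ∧ 0 ≤ x + l + t

theorem GG_inj_posl (k : ℕ) (hk : k = 5 ∨ k = 6 ∨ k = 7) (x y l t : ℤ)
    (hx : Cor x l t) (hy : Cor y l t)
    (hl : 0 < l) (ht : t ≠ 0) (h : GG k x l t = GG k y l t) : x = y := by
  rcases lt_or_gt_of_ne ht with h1 | h1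
  · have := GG_inj_pos k hk (x + t) (y + t) l (-t) hx.2.2.1 hy.2.2.1 hl (by linarith)
      (by rw [GG_negt, GG_negt, h])
    linarith
  · exact GG_inj_pos k hk x y l t hx.1 hy.1 hl h1 h

theorem GG_inj (k : ℕ) (hk : k = 5 ∨ k = 6 ∨ k = 7) (x y l t : ℤ)
    (hx : Cor x l t) (hy : Cor y l t)
    (hl : l ≠ 0) (ht : t ≠ 0) (h : GG k x l t = GG k y l t) : x = y := by
  rcases lt_or_gt_of_ne hl with h1 | h1
  · have := GG_inj_posl k hk (x + l) (y + l) (-l) t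
      (by unfold Cor at *; refine ⟨?_, ?_, ?_, ?_⟩ <;> linarith)
      (by unfold Cor at *; refine ⟨?_, ?_, ?_, ?_⟩ <;> linarith) (by linarith) ht
      (by rw [GG_negl, GG_negl, h])
    linarith
  · exact GG_inj_posl k hk x y l t hx hy h1 ht h

theorem GG_ne (k : ℕ) (hk : k = 5 ∨ k = 6 ∨ k = 7) (x l t : ℤ)
    (hx : Cor x l t) (hl : l ≠ 0) (ht : t ≠ 0) : GG k x l t ≠ 0 := by
  obtain ⟨h1, h2, h3, h4⟩ := hx
  rcases lt_or_gt_of_ne hl with hl | hl <;> rcases lt_or_gt_of_ne ht with ht | ht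
  · have := GG_pos k hk (x + l + t) (-l) (-t) h4 (by linarith) (by linarith)
    rw [GG_negt, show x + l = x + l by rfl, GG_negl] at this
    linarith
  · have := GG_pos k hk (x + l) (-l) t h2 (by linarith) (by linarith)
    rw [GG_negl] at this
    linarith
  · have := GG_pos k hk (x + t) l (-t) h3 (by linarith) (by linarith)
    rw [GG_negt] at this
    linarith
  · exact ne_of_gt (GG_pos k hk x l t h1 hl ht)

/-- sum of two fifth powers -/
def s5 (a : ℤ × ℤ) : ℤ := a.1 ^ 5 + a.2 ^ 5

/-- difference of two powers -/
def dk (k : ℕ) (a : ℤ × ℤ) : ℤ := a.1 ^ k - a.2 ^ k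

/-- difference -/
def df (a : ℤ × ℤ) : ℤ := a.1 - a.2

def G2 (k : ℕ) (q : (ℤ × ℤ) × (ℤ × ℤ)) : ℤ := dk k q.1 - dk k q.2

/-- pairs of distinct elements with equal differences -/
def S2 (S : Finset (ℤ × ℤ)) : Finset ((ℤ × ℤ) × (ℤ × ℤ)) :=
  {q ∈ S ×ˢ S | q.1 ≠ q.2 ∧ df q.1 = df q.2}

theorem mem_S2 (S : Finset (ℤ × ℤ)) (q : (ℤ × ℤ) × (ℤ × ℤ)) :
    q ∈ S2 S ↔ (q.1 ∈ S ∧ q.2 ∈ S) ∧ q.1 ≠ q.2 ∧ df q.1 = df q.2 := by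
  unfold S2
  rw [mem_filter, mem_product]

theorem pw_helper (a1 a2 b1 b2 : ℤ) (h0 : 0 ≤ a1) (h1 : a1 < b1) (h2 : a1 < b2)
    (h : a1 + a2 = b1 + b2) : b1 ^ 5 + b2 ^ 5 < a1 ^ 5 + a2 ^ 5 := by
  have := GG_pos 5 (by simp) a1 (b2 - a1) (b1 - a1) h0 (by linarith) (by linarith)
  unfold GG at this
  rw [show a1 + (b2 - a1) + (b1 - a1) = a2 by linarith, show a1 + (b2 - a1) = b2 by ring,
    show a1 + (b1 - a1) = b1 by ring] at this
  linarith

theorem pw_inj (a1 a2 b1 b2 : ℤ) (h0 : 0 ≤ a1) (h0' : 0 ≤ b1) (h1 : a1 ≤ a2) (h2 : b1 ≤ b2)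
    (h : a1 + a2 = b1 + b2) (hs : a1 ^ 5 + a2 ^ 5 = b1 ^ 5 + b2 ^ 5) : a1 = b1 := by
  rcases lt_trichotomy a1 b1 with h3 | h3 | h3
  · have := pw_helper a1 a2 b1 b2 h0 h3 (by linarith) h
    linarith
  · exact h3
  · have := pw_helper b1 b2 a1 a2 h0' h3 (by linarith) h.symm
    linarith

theorem r_bound (M D : ℕ) (hD : ∀ m : ℕ, 0 < m → m ≤ M → #m.divisors ≤ D) (Zs : Finset ℤ)
    (hZ : ∀ z ∈ Zs, 0 < z) (hM : ∀ z ∈ Zs, 2 * z ^ 5 ≤ M) (m : ℤ) :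
    #{a ∈ Zs ×ˢ Zs | s5 a = m} ≤ 2 * D := by
  rcases Finset.eq_empty_or_nonempty ({a ∈ Zs ×ˢ Zs | s5 a = m}) with h | ⟨a0, h⟩
  · rw [h]; simp
  simp only [mem_filter, mem_product] at h
  simp only [s5] at h
  obtain ⟨⟨h1, h2⟩, h3⟩ := h
  have p1 := hZ _ h1
  have p2 := hZ _ h2
  have q1 := hM _ h1
  have q2 := hM _ h2
  have hm0 : 0 < m := by rw [← h3]; positivity
  have hmM : m ≤ M := by linarith
  have hd := hD m.natAbs (by omega) (by omega)
  refine le_trans (Finset.card_le_card_of_injOn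
    (t := m.natAbs.divisors ×ˢ (Finset.univ : Finset Bool))
    (fun a => ((a.1 + a.2).natAbs, decide (a.1 ≤ a.2))) ?_ ?_) ?_
  · intro a ha
    simp only [coe_filter, mem_product, Set.mem_ofPred_eq] at ha
    simp only [s5] at ha
    simp only [coe_product, Set.mem_prod, mem_coe, Nat.mem_divisors, mem_univ, and_true]
    refine ⟨?_, by omega⟩
    rw [Int.natAbs_dvd_natAbs, ← ha.2]
    exact Odd.add_dvd_pow_add_pow _ _ (by decide)
  · rintro ⟨a1, a2⟩ ha ⟨b1, b2⟩ hb hab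
    simp only [coe_filter, mem_product, Set.mem_ofPred_eq] at ha hb
    simp only [s5] at ha hb
    simp only [Prod.mk.injEq, decide_eq_decide] at hab
    have pa1 := hZ _ ha.1.1
    have pa2 := hZ _ ha.1.2
    have pb1 := hZ _ hb.1.1
    have pb2 := hZ _ hb.1.2
    have hsum : a1 + a2 = b1 + b2 := by omega
    by_cases hle : a1 ≤ a2
    · have := pw_inj a1 a2 b1 b2 pa1.le pb1.le hle (hab.2.1 hle) hsum (by linarith)
      ext <;> simp <;> linarith
    · have hle' : ¬ b1 ≤ b2 := fun h => hle (hab.2.2 h)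
      have := pw_inj a2 a1 b2 b1 pa2.le pb2.le (by linarith) (by linarith)
        (by linarith) (by linarith)
      ext <;> simp <;> linarith
  · rw [card_product, mul_comm]
    simp
    exact hd

theorem G2_fib (M D : ℕ) (hD : ∀ m : ℕ, 0 < m → m ≤ M → #m.divisors ≤ D) (k : ℕ)
    (hk : k = 5 ∨ k = 6 ∨ k = 7) (Ws : Finset ℤ) (hW : ∀ z ∈ Ws, 0 < z)
    (hM : ∀ z ∈ Ws, 2 * z ^ k ≤ M) (S : Finset (ℤ × ℤ))
    (hS : ∀ p ∈ S, p.1 ∈ Ws ∧ p.2 ∈ Ws ∧ p.1 ≠ p.2) (m : ℤ) :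
    #{q ∈ S2 S | G2 k q = m} ≤ 4 * D ^ 2 := by
  have key : ∀ q ∈ S2 S, G2 k q = GG k q.2.2 (df q.1) (q.1.1 - q.2.1) ∧ df q.1 ≠ 0 ∧
      q.1.1 - q.2.1 ≠ 0 ∧ Cor q.2.2 (df q.1) (q.1.1 - q.2.1) ∧ df q.1 ∣ G2 k q ∧
      (q.1.1 - q.2.1) ∣ G2 k q ∧ (G2 k q).natAbs ≤ M := by
    rintro ⟨⟨a, b⟩, ⟨a', b'⟩⟩ hq
    rw [mem_S2] at hq
    simp only [df, ne_eq, Prod.mk.injEq] at hq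
    obtain ⟨⟨h1, h2⟩, h3, h4⟩ := hq
    obtain ⟨wa, wb, wab⟩ := hS _ h1
    obtain ⟨wa', wb', wab'⟩ := hS _ h2
    simp only at wa wb wab wa' wb' wab'
    have p1 := hW _ wa
    have p2 := hW _ wb
    have p3 := hW _ wa'
    have p4 := hW _ wb'
    have m1 := hM _ wa
    have m2 := hM _ wb
    have m3 := hM _ wa'
    have m4 := hM _ wb'
    have n1 := pow_pos p1 k
    have n2 := pow_pos p2 k
    have n3 := pow_pos p3 k
    have n4 := pow_pos p4 k
    simp only [G2, dk, df, GG]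
    have e1 : b' + (a - b) + (a - a') = a := by linarith
    have e2 : b' + (a - b) = a' := by linarith
    have e3 : b' + (a - a') = b := by linarith
    refine ⟨?_, ?_, ?_, ?_, ?_, ?_, ?_⟩
    · rw [e1, e2, e3]; ring
    · intro h; apply wab; linarith
    · intro h; apply h3; constructor <;> linarith
    · unfold Cor
      rw [e1, e2, e3]
      exact ⟨p4.le, p3.le, p2.le, p1.le⟩
    · refine dvd_sub (sub_dvd_pow_sub_pow _ _ _) ?_
      rw [h4]; exact sub_dvd_pow_sub_pow _ _ _
    · have : a ^ k - b ^ k - (a' ^ k - b' ^ k) = (a ^ k - a' ^ k) - (b ^ k - b' ^ k) := by ring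
      rw [this]
      refine dvd_sub (sub_dvd_pow_sub_pow _ _ _) ?_
      rw [show a - a' = b - b' by linarith]; exact sub_dvd_pow_sub_pow _ _ _
    · omega
  rcases Finset.eq_empty_or_nonempty ({q ∈ S2 S | G2 k q = m}) with h | ⟨a0, h⟩
  · rw [h]; simp
  rw [mem_filter] at h
  obtain ⟨k1, k2, k3, k4, k5, k6, k7⟩ := key _ h.1
  have hm0 : m ≠ 0 := by rw [← h.2, k1]; exact GG_ne k hk _ _ _ k4 k2 k3
  have hd := hD m.natAbs (by omega) (by rw [← h.2]; exact k7)
  refine le_trans (Finset.card_le_card_of_injOn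
    (t := (m.natAbs.divisors ×ˢ m.natAbs.divisors) ×ˢ (Finset.univ : Finset (Bool × Bool)))
    (fun q => (((df q.1).natAbs, (q.1.1 - q.2.1).natAbs),
      (decide (0 < df q.1), decide (0 < q.1.1 - q.2.1)))) ?_ ?_) ?_
  · intro q hq
    simp only [coe_filter, Set.mem_ofPred_eq] at hq
    obtain ⟨k1, k2, k3, k4, k5, k6, k7⟩ := key _ hq.1
    rw [hq.2] at k5 k6
    simp only [coe_product, Set.mem_prod, mem_coe, Nat.mem_divisors, mem_univ, and_true,
      Int.natAbs_dvd_natAbs]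
    exact ⟨⟨k5, by omega⟩, ⟨k6, by omega⟩⟩
  · intro q hq q' hq' he
    simp only [coe_filter, Set.mem_ofPred_eq] at hq hq'
    obtain ⟨k1, k2, k3, k4, k5, k6, k7⟩ := key _ hq.1
    obtain ⟨k1', k2', k3', k4', k5', k6', k7'⟩ := key _ hq'.1
    simp only [Prod.mk.injEq, decide_eq_decide] at he
    obtain ⟨⟨e1, e2⟩, e3, e4⟩ := he
    have d1 : df q.1 = df q'.1 := by omega
    have d2 : q.1.1 - q.2.1 = q'.1.1 - q'.2.1 := by omega
    have e5 : q.2.2 = q'.2.2 := by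
      rw [← d1, ← d2] at k1' k4'
      exact GG_inj k hk _ _ _ _ k4 k4' k2 k3 (by rw [← k1, ← k1', hq.2, hq'.2])
    have f1 := hq.1
    have f2 := hq'.1
    rw [mem_S2] at f1 f2
    simp only [df] at f1 f2 d1
    have g1 := f1.2.2
    have g2 := f2.2.2
    ext <;> linarith
  · rw [card_product, card_product]
    have : #(Finset.univ : Finset (Bool × Bool)) = 4 := rfl
    rw [this, mul_comm, sq]
    gcongr

theorem split_key (k : ℕ) (S A : Finset (ℤ × ℤ)) :
    En (S ×ˢ A) (fun x => (dk k x.1 + s5 x.2, df x.1)) ≤ #S * En A s5 +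
      #{x ∈ S2 S ×ˢ (A ×ˢ A) | G2 k x.1 = s5 x.2.2 - s5 x.2.1} := by
  classical
  unfold En
  rw [← card_product, ← Finset.card_disjSum]
  refine Finset.card_le_card_of_injOn (fun x => if x.1.1 = x.2.1 then
    Sum.inl (x.1.1, (x.1.2, x.2.2)) else Sum.inr ((x.1.1, x.2.1), (x.1.2, x.2.2))) ?_ ?_
  · rintro ⟨⟨p, a⟩, ⟨p', a'⟩⟩ hx
    simp only [coe_filter, mem_product, Set.mem_ofPred_eq, Prod.mk.injEq] at hx
    obtain ⟨⟨⟨h1, h2⟩, h3, h4⟩, h5, h6⟩ := hx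
    simp only [mem_coe]
    split_ifs with h
    · rw [inl_mem_disjSum]
      simp only [mem_product, mem_filter]
      refine ⟨h1, ⟨h2, h4⟩, ?_⟩
      rw [h] at h5; linarith
    · rw [inr_mem_disjSum]
      simp only [mem_product, mem_filter, mem_S2]
      unfold G2
      exact ⟨⟨⟨⟨h1, h3⟩, h, h6⟩, h2, h4⟩, by linarith⟩
  · rintro ⟨⟨p, a⟩, ⟨p', a'⟩⟩ hx ⟨⟨r, b⟩, ⟨r', b'⟩⟩ hy he
    simp only at he
    split_ifs at he with h1 h2 h2 <;> simp_all

theorem En_s5 (D : ℕ) (Zs : Finset ℤ) (hr : ∀ m, #{a ∈ Zs ×ˢ Zs | s5 a = m} ≤ 2 * D) :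
    En (Zs ×ˢ Zs) s5 ≤ (#Zs) ^ 2 * (2 * D) := by
  refine (fib_key _ _ _ _ _ hr).trans ?_
  rw [card_product, sq]

theorem V8_re (Zs : Finset ℤ) :
    En ((Zs ×ˢ Zs) ×ˢ (Zs ×ˢ Zs)) (fun c => s5 c.2 - s5 c.1) ≤
    En ((Zs ×ˢ Zs) ×ˢ (Zs ×ˢ Zs)) (fun c => dk 5 c.1 + s5 c.2) := by
  unfold En
  refine Finset.card_le_card_of_injOn (fun x =>
    (((x.1.2.1, x.1.1.1), (x.2.1.1, x.2.1.2)), ((x.1.1.2, x.1.2.2), (x.2.2.1, x.2.2.2)))) ?_ ?_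
  · rintro ⟨⟨⟨a1, a2⟩, ⟨a1', a2'⟩⟩, ⟨⟨b1, b2⟩, ⟨b1', b2'⟩⟩⟩ hx
    simp only [coe_filter, mem_product, Set.mem_ofPred_eq] at hx ⊢
    simp only [s5, dk] at hx ⊢
    refine ⟨by tauto, by linarith⟩
  · rintro ⟨⟨⟨a1, a2⟩, ⟨a1', a2'⟩⟩, ⟨⟨b1, b2⟩, ⟨b1', b2'⟩⟩⟩ hx
      ⟨⟨⟨c1, c2⟩, ⟨c1', c2'⟩⟩, ⟨⟨d1, d2⟩, ⟨d1', d2'⟩⟩⟩ hy he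
    simp only [Prod.mk.injEq] at he ⊢
    tauto

theorem V8_bound (M D : ℕ) (hD : ∀ m : ℕ, 0 < m → m ≤ M → #m.divisors ≤ D) (Z : ℕ)
    (hM : 2 * Z ^ 5 ≤ M) :
    En (((Icc 1 (Z : ℤ)) ×ˢ (Icc 1 (Z : ℤ))) ×ˢ ((Icc 1 (Z : ℤ)) ×ˢ (Icc 1 (Z : ℤ))))
      (fun c => s5 c.2 - s5 c.1) ≤ (2 * Z + 1) * (4 * D * Z ^ 4 + 4 * D ^ 2 * Z ^ 4) := by
  classical
  refine (V8_re _).trans ?_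
  set Zs := Icc 1 (Z : ℤ) with hZs
  have cZ : #Zs = Z := by simp [hZs]
  have hZ : ∀ z ∈ Zs, 0 < z := by intro z hz; rw [hZs, mem_Icc] at hz; omega
  have hZM : ∀ z ∈ Zs, 2 * z ^ 5 ≤ M := by
    intro z hz
    rw [hZs, mem_Icc] at hz
    have : z ^ 5 ≤ (Z : ℤ) ^ 5 := pow_le_pow_left₀ (by omega) hz.2 5
    have h2 : (2 * (Z : ℤ) ^ 5) ≤ M := by exact_mod_cast hM
    linarith
  have hr := r_bound M D hD Zs hZ hZM
  refine (pig_key _ _ (fun c => df c.1) (Icc (-(Z : ℤ)) Z) ?_).trans ?_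
  · intro c hc
    simp only [hZs, mem_product, mem_Icc, df] at hc ⊢
    omega
  have cL : #(Icc (-(Z : ℤ)) Z) = 2 * Z + 1 := by simp; omega
  rw [cL]
  gcongr
  -- split according to zero difference
  set S0 := {p ∈ Zs ×ˢ Zs | p.1 = p.2} with hS0
  set S1 := {p ∈ Zs ×ˢ Zs | p.1 ≠ p.2} with hS1
  have c0 : #S0 ≤ Z := by
    rw [← cZ]
    refine Finset.card_le_card_of_injOn (fun p => p.1) ?_ ?_
    · intro p hp
      simp only [hS0, coe_filter, mem_product, Set.mem_ofPred_eq] at hp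
      exact hp.1.1
    · rintro ⟨a, b⟩ hp ⟨c, d⟩ hq he
      simp only [hS0, coe_filter, mem_product, Set.mem_ofPred_eq] at hp hq he
      ext <;> simp <;> linarith
  have c1 : #S1 ≤ Z ^ 2 := by
    refine (card_filter_le _ _).trans ?_
    rw [card_product, cZ, sq]
  have hsplit : En ((Zs ×ˢ Zs) ×ˢ (Zs ×ˢ Zs)) (fun x => (dk 5 x.1 + s5 x.2, df x.1)) ≤
      En (S0 ×ˢ (Zs ×ˢ Zs)) (fun x => (dk 5 x.1 + s5 x.2, df x.1)) +
      En (S1 ×ˢ (Zs ×ˢ Zs)) (fun x => (dk 5 x.1 + s5 x.2, df x.1)) := by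
    unfold En
    refine le_trans (card_le_card ?_) (card_union_le _ _)
    rintro ⟨⟨⟨a, b⟩, c⟩, ⟨⟨a', b'⟩, c'⟩⟩ hx
    simp only [hS0, hS1, mem_union, mem_filter, mem_product, df, Prod.mk.injEq] at hx ⊢
    by_cases hab : a = b
    · left
      have : a' = b' := by have := hx.2.2; omega
      tauto
    · right
      have : a' ≠ b' := by have := hx.2.2; omega
      tauto
  have b0 : En (S0 ×ˢ (Zs ×ˢ Zs)) (fun x => (dk 5 x.1 + s5 x.2, df x.1)) ≤ 2 * D * Z ^ 4 := by
    have : En (S0 ×ˢ (Zs ×ˢ Zs)) (fun x => (dk 5 x.1 + s5 x.2, df x.1)) ≤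
        #(S0 ×ˢ S0) * En (Zs ×ˢ Zs) s5 := by
      unfold En
      rw [← card_product]
      refine Finset.card_le_card_of_injOn
        (fun x => ((x.1.1, x.2.1), (x.1.2, x.2.2))) ?_ ?_
      · rintro ⟨⟨⟨a, b⟩, c⟩, ⟨⟨a', b'⟩, c'⟩⟩ hx
        simp only [hS0, coe_filter, Set.mem_ofPred_eq, mem_coe, mem_filter, mem_product, df,
          Prod.mk.injEq, dk] at hx ⊢
        obtain ⟨⟨⟨⟨h1, h2⟩, h3⟩, ⟨h4, h5⟩, h6⟩, h7, h8⟩ := hx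
        refine ⟨⟨⟨h1, h2⟩, h4, h5⟩, ⟨h3, h6⟩, ?_⟩
        subst h2 h5
        linarith
      · rintro ⟨⟨p, c⟩, ⟨p', c'⟩⟩ hx ⟨⟨q, d⟩, ⟨q', d'⟩⟩ hy he
        simp only [Prod.mk.injEq] at he ⊢
        tauto
    refine this.trans ?_
    have e := En_s5 D Zs hr
    rw [cZ] at e
    rw [card_product]
    calc #S0 * #S0 * En (Zs ×ˢ Zs) s5 ≤ Z * Z * (Z ^ 2 * (2 * D)) := by gcongr
      _ = _ := by ring
  have b1 : En (S1 ×ˢ (Zs ×ˢ Zs)) (fun x => (dk 5 x.1 + s5 x.2, df x.1)) ≤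
      2 * D * Z ^ 4 + 4 * D ^ 2 * Z ^ 4 := by
    refine (split_key 5 S1 (Zs ×ˢ Zs)).trans ?_
    have e := En_s5 D Zs hr
    rw [cZ] at e
    have g := fib_key' (S2 S1) ((Zs ×ˢ Zs) ×ˢ (Zs ×ˢ Zs)) (G2 5) (fun x => s5 x.2 - s5 x.1) _
      (G2_fib M D hD 5 (by simp) Zs hZ hZM S1 (by
        intro p hp
        simp only [hS1, mem_filter, mem_product] at hp
        exact ⟨hp.1.1, hp.1.2, hp.2⟩))
    simp only [card_product, cZ] at g
    calc _ ≤ Z ^ 2 * (Z ^ 2 * (2 * D)) + Z * Z * (Z * Z) * (4 * D ^ 2) := by gcongr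
      _ = _ := by ring
  calc _ ≤ _ := hsplit
    _ ≤ 2 * D * Z ^ 4 + (2 * D * Z ^ 4 + 4 * D ^ 2 * Z ^ 4) := by gcongr
    _ = _ := by ring

/-- close pairs of distinct elements -/
def Scl (Ys : Finset ℤ) (H : ℕ) : Finset (ℤ × ℤ) :=
  {p ∈ Ys ×ˢ Ys | p.1 ≠ p.2 ∧ |p.1 - p.2| ≤ (H : ℤ)}

theorem mem_Scl (Ys : Finset ℤ) (H : ℕ) (p : ℤ × ℤ) :
    p ∈ Scl Ys H ↔ (p.1 ∈ Ys ∧ p.2 ∈ Ys) ∧ p.1 ≠ p.2 ∧ |p.1 - p.2| ≤ (H : ℤ) := by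
  unfold Scl
  rw [mem_filter, mem_product]

theorem K_bound (M D : ℕ) (hD : ∀ m : ℕ, 0 < m → m ≤ M → #m.divisors ≤ D) (Z H c : ℕ)
    (hc : c = 6 ∨ c = 7) (hM : 2 * Z ^ 5 ≤ M) (Ys : Finset ℤ) (hY : ∀ y ∈ Ys, 0 < y)
    (hYM : ∀ y ∈ Ys, 2 * y ^ c ≤ M) :
    ∃ q : ℕ, q ^ 2 ≤ (#Ys ^ 2 * (2 * H + 1) * (4 * D ^ 2)) *
        ((2 * Z + 1) * (4 * D * Z ^ 4 + 4 * D ^ 2 * Z ^ 4)) ∧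
      #{x ∈ (Scl Ys H ×ˢ (Icc 1 (Z : ℤ) ×ˢ Icc 1 (Z : ℤ))) ×ˢ (Icc 1 (Z : ℤ) ×ˢ Icc 1 (Z : ℤ)) |
        dk c x.1.1 + s5 x.1.2 = s5 x.2} ^ 2 ≤
        ((2 * H + 1) * (#Ys * (2 * H + 1) * (Z ^ 2 * (2 * D)) + q)) * (Z ^ 2 * (2 * D)) := by
  classical
  have hV := V8_bound M D hD Z hM
  set Zs := Icc 1 (Z : ℤ) with hZs
  have cZ : #Zs = Z := by simp [hZs]
  have hZ : ∀ z ∈ Zs, 0 < z := by intro z hz; rw [hZs, mem_Icc] at hz; omega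
  have hZM : ∀ z ∈ Zs, 2 * z ^ 5 ≤ M := by
    intro z hz
    rw [hZs, mem_Icc] at hz
    have : z ^ 5 ≤ (Z : ℤ) ^ 5 := pow_le_pow_left₀ (by omega) hz.2 5
    have h2 : (2 * (Z : ℤ) ^ 5) ≤ M := by exact_mod_cast hM
    linarith
  have hr := r_bound M D hD Zs hZ hZM
  have e := En_s5 D Zs hr
  rw [cZ] at e
  set Sc := Scl Ys H with hSc
  have cL : #(Icc (-(H : ℤ)) H) = 2 * H + 1 := by simp; omega
  have cS : #Sc ≤ #Ys * (2 * H + 1) := by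
    rw [← cL, ← card_product]
    refine Finset.card_le_card_of_injOn (fun p => (p.1, p.1 - p.2)) ?_ ?_
    · rintro ⟨a, b⟩ hp
      rw [mem_coe, hSc, mem_Scl] at hp
      simp only [abs_le] at hp
      simp only [coe_product, Set.mem_prod, mem_coe, mem_Icc]
      exact ⟨hp.1.1, hp.2.2⟩
    · rintro ⟨a, b⟩ hp ⟨a', b'⟩ hp' he
      simp only [Prod.mk.injEq] at he ⊢
      omega
  have cS2 : #(S2 Sc) ≤ #Ys ^ 2 * (2 * H + 1) := by
    calc #(S2 Sc) ≤ #(Sc ×ˢ Ys) := by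
          refine Finset.card_le_card_of_injOn (fun q => (q.1, q.2.1)) ?_ ?_
          · rintro ⟨p, p'⟩ hp
            rw [mem_coe, mem_S2] at hp
            have h2 := hp.1.2
            rw [hSc, mem_Scl] at h2
            simp only [coe_product, Set.mem_prod, mem_coe]
            exact ⟨hp.1.1, h2.1.1⟩
          · rintro ⟨⟨a, b⟩, ⟨a', b'⟩⟩ hp ⟨⟨c, d⟩, ⟨c', d'⟩⟩ hq he
            rw [mem_coe, mem_S2] at hp hq
            simp only [df] at hp hq
            simp only [Prod.mk.injEq] at he ⊢
            have h1 := hp.2.2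
            have h2 := hq.2.2
            omega
      _ ≤ #Ys * (2 * H + 1) * #Ys := by rw [card_product]; gcongr
      _ = _ := by ring
  have hfib := G2_fib M D hD c (by tauto) Ys hY hYM Sc (by
        intro p hp
        rw [hSc, mem_Scl] at hp
        exact ⟨hp.1.1, hp.1.2, hp.2.1⟩)
  refine ⟨#{x ∈ S2 Sc ×ˢ ((Zs ×ˢ Zs) ×ˢ (Zs ×ˢ Zs)) | G2 c x.1 = s5 x.2.2 - s5 x.2.1}, ?_, ?_⟩
  · refine (cs_key (S2 Sc) ((Zs ×ˢ Zs) ×ˢ (Zs ×ˢ Zs)) (G2 c) (fun x => s5 x.2 - s5 x.1)).trans ?_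
    refine Nat.mul_le_mul ?_ hV
    refine (fib_key (S2 Sc) (S2 Sc) (G2 c) (G2 c) _ hfib).trans ?_
    gcongr
  · refine (cs_key (Sc ×ˢ (Zs ×ˢ Zs)) (Zs ×ˢ Zs) (fun x => dk c x.1 + s5 x.2) s5).trans ?_
    refine Nat.mul_le_mul ?_ e
    refine (pig_key _ _ (fun x => df x.1) (Icc (-(H : ℤ)) H) ?_).trans ?_
    · rintro ⟨p, a⟩ hx
      rw [mem_product, hSc, mem_Scl] at hx
      have := hx.1.2.2
      rw [abs_le] at this
      simp only [df, mem_Icc]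
      exact this
    rw [cL]
    gcongr
    refine (split_key c Sc (Zs ×ˢ Zs)).trans ?_
    gcongr

theorem x_fib (M D : ℕ) (hD : ∀ m : ℕ, 0 < m → m ≤ M → #m.divisors ≤ D) (Xs : Finset ℤ)
    (hX : ∀ x ∈ Xs, 0 < x) (hXM : ∀ x ∈ Xs, x ^ 2 ≤ M) (m : ℤ) :
    #{p ∈ {p ∈ Xs ×ˢ Xs | p.1 ≠ p.2} | dk 2 p = m} ≤ D := by
  have key : ∀ p ∈ {p ∈ {p ∈ Xs ×ˢ Xs | p.1 ≠ p.2} | dk 2 p = m},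
      0 < p.1 ∧ 0 < p.2 ∧ p.1 ≠ p.2 ∧ (p.1 + p.2) * (p.1 - p.2) = m ∧ m.natAbs ≤ M ∧ m ≠ 0 := by
    intro p hp
    simp only [mem_filter, mem_product] at hp
    obtain ⟨⟨⟨h1, h2⟩, h3⟩, h4⟩ := hp
    simp only [dk] at h4
    have p1 := hX _ h1
    have p2 := hX _ h2
    have m1 := hXM _ h1
    have m2 := hXM _ h2
    have e : (p.1 + p.2) * (p.1 - p.2) = m := by rw [← h4]; ring
    have n1 := pow_pos p1 2
    have n2 := pow_pos p2 2
    refine ⟨p1, p2, h3, e, by omega, ?_⟩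
    rw [← e]
    exact mul_ne_zero (by omega) (by omega)
  rcases Finset.eq_empty_or_nonempty ({p ∈ {p ∈ Xs ×ˢ Xs | p.1 ≠ p.2} | dk 2 p = m})
    with h | ⟨a0, h⟩
  · rw [h]; simp
  obtain ⟨_, _, _, _, k1, k2⟩ := key _ h
  refine le_trans (Finset.card_le_card_of_injOn
    (t := m.natAbs.divisors) (fun p => (p.1 + p.2).natAbs) ?_ ?_) (hD m.natAbs (by omega) k1)
  · intro p hp
    obtain ⟨h1, h2, h3, h4, h5, h6⟩ := key _ hp
    rw [mem_coe, Nat.mem_divisors]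
    refine ⟨?_, by omega⟩
    rw [Int.natAbs_dvd_natAbs, ← h4]
    exact dvd_mul_right _ _
  · intro p hp q hq he
    obtain ⟨h1, h2, h3, h4, h5, h6⟩ := key _ hp
    obtain ⟨g1, g2, g3, g4, g5, g6⟩ := key _ hq
    simp only at he
    have e1 : p.1 + p.2 = q.1 + q.2 := by omega
    have e2 : p.1 - p.2 = q.1 - q.2 := by
      rw [e1, ← g4] at h4
      exact mul_left_cancel₀ (by omega) h4
    ext <;> omega

theorem N_comb (M D : ℕ) (hD : ∀ m : ℕ, 0 < m → m ≤ M → #m.divisors ≤ D) (Z H c : ℕ)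
    (hc : c = 6 ∨ c = 7) (hM : 2 * Z ^ 5 ≤ M) (Ys : Finset ℤ) (hY : ∀ y ∈ Ys, 0 < y)
    (hYM : ∀ y ∈ Ys, 2 * y ^ c ≤ M)
    (hYH : ∀ a ∈ Ys, ∀ b ∈ Ys, |a ^ c - b ^ c| ≤ 2 * (Z : ℤ) ^ 5 → |a - b| ≤ H)
    (Xs : Finset ℤ) (hX : ∀ x ∈ Xs, 0 < x) (hXM : ∀ x ∈ Xs, x ^ 2 ≤ M) :
    ∃ q K : ℕ, q ^ 2 ≤ (#Ys ^ 2 * (2 * H + 1) * (4 * D ^ 2)) *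
        ((2 * Z + 1) * (4 * D * Z ^ 4 + 4 * D ^ 2 * Z ^ 4)) ∧
      K ^ 2 ≤
        ((2 * H + 1) * (#Ys * (2 * H + 1) * (Z ^ 2 * (2 * D)) + q)) * (Z ^ 2 * (2 * D)) ∧
      #{w ∈ (Xs ×ˢ Xs) ×ˢ (((Ys ×ˢ Ys) ×ˢ (Icc 1 (Z : ℤ) ×ˢ Icc 1 (Z : ℤ))) ×ˢ
          (Icc 1 (Z : ℤ) ×ˢ Icc 1 (Z : ℤ))) |
          dk 2 w.1 = dk c w.2.1.1 + s5 w.2.1.2 - s5 w.2.2} ≤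
        #Xs * (#Ys * (Z ^ 2 * (2 * D)) + K) + #Ys ^ 2 * Z ^ 4 * D := by
  classical
  obtain ⟨q, hq, hK⟩ := K_bound M D hD Z H c hc hM Ys hY hYM
  refine ⟨q, _, hq, hK, ?_⟩
  set Zs := Icc 1 (Z : ℤ) with hZs
  have cZ : #Zs = Z := by simp [hZs]
  have hZ : ∀ z ∈ Zs, 0 < z := by intro z hz; rw [hZs, mem_Icc] at hz; omega
  have hZ5 : ∀ z ∈ Zs, 0 < z ^ 5 ∧ z ^ 5 ≤ (Z : ℤ) ^ 5 := by
    intro z hz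
    refine ⟨pow_pos (hZ z hz) 5, ?_⟩
    rw [hZs, mem_Icc] at hz
    exact pow_le_pow_left₀ (by omega) hz.2 5
  have hZM : ∀ z ∈ Zs, 2 * z ^ 5 ≤ M := by
    intro z hz
    have := (hZ5 z hz).2
    have h2 : (2 * (Z : ℤ) ^ 5) ≤ M := by exact_mod_cast hM
    linarith
  have hr := r_bound M D hD Zs hZ hZM
  have e := En_s5 D Zs hr
  rw [cZ] at e
  have hdiag : ∀ Ws : Finset ℤ, #{p ∈ Ws ×ˢ Ws | p.1 = p.2} ≤ #Ws := by
    intro Ws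
    refine Finset.card_le_card_of_injOn (fun p => p.1) ?_ ?_
    · intro p hp
      simp only [coe_filter, mem_product, Set.mem_ofPred_eq] at hp
      exact hp.1.1
    · rintro ⟨a, b⟩ hp ⟨c, d⟩ hq he
      simp only [coe_filter, mem_product, Set.mem_ofPred_eq] at hp hq he
      ext <;> simp <;> linarith
  set B := ((Ys ×ˢ Ys) ×ˢ (Zs ×ˢ Zs)) ×ˢ (Zs ×ˢ Zs) with hB
  set T := {b ∈ B | dk c b.1.1 + s5 b.1.2 = s5 b.2} with hT
  have cB : #B = #Ys ^ 2 * Z ^ 4 := by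
    simp only [hB, card_product, cZ]; ring
  have hTb : #T ≤ #Ys * (Z ^ 2 * (2 * D)) +
      #{x ∈ (Scl Ys H ×ˢ (Zs ×ˢ Zs)) ×ˢ (Zs ×ˢ Zs) | dk c x.1.1 + s5 x.1.2 = s5 x.2} := by
    have h1 : #{b ∈ ({p ∈ Ys ×ˢ Ys | p.1 = p.2} ×ˢ (Zs ×ˢ Zs)) ×ˢ (Zs ×ˢ Zs) |
        s5 b.1.2 = s5 b.2} ≤ #Ys * (Z ^ 2 * (2 * D)) := by
      refine le_trans ?_ (Nat.mul_le_mul (hdiag Ys) e)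
      unfold En
      rw [← card_product]
      refine Finset.card_le_card_of_injOn (fun x => (x.1.1, (x.1.2, x.2))) ?_ ?_
      · rintro ⟨⟨p, a⟩, b⟩ hx
        simp only [coe_filter, mem_product, Set.mem_ofPred_eq, mem_coe, mem_filter] at hx ⊢
        tauto
      · rintro ⟨⟨p, a⟩, b⟩ hx ⟨⟨p', a'⟩, b'⟩ hy he
        simp only [Prod.mk.injEq] at he ⊢
        tauto
    refine le_trans (le_trans (card_le_card ?_) (card_union_le _ _)) (Nat.add_le_add_right h1 _)
    rintro ⟨⟨⟨y1, y2⟩, a⟩, b⟩ hx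
    simp only [hT, hB, mem_filter, mem_product, mem_union, mem_Scl] at hx ⊢
    obtain ⟨⟨⟨⟨h1, h2⟩, ha⟩, hb⟩, he⟩ := hx
    by_cases hy : y1 = y2
    · left
      subst hy
      refine ⟨⟨⟨⟨⟨h1, h2⟩, rfl⟩, ha⟩, hb⟩, ?_⟩
      simpa [dk] using he
    · right
      refine ⟨⟨⟨⟨⟨h1, h2⟩, hy, ?_⟩, ha⟩, hb⟩, he⟩
      apply hYH _ h1 _ h2
      simp only [dk, s5] at he
      have a1 := hZ5 _ ha.1
      have a2 := hZ5 _ ha.2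
      have b1 := hZ5 _ hb.1
      have b2 := hZ5 _ hb.2
      rw [abs_le]
      constructor <;> linarith
  have hx1 : #{w ∈ {p ∈ Xs ×ˢ Xs | p.1 ≠ p.2} ×ˢ B |
      dk 2 w.1 = dk c w.2.1.1 + s5 w.2.1.2 - s5 w.2.2} ≤ #Ys ^ 2 * Z ^ 4 * D := by
    rw [← cB]
    exact fib_key' _ B (dk 2) (fun b => dk c b.1.1 + s5 b.1.2 - s5 b.2) D
      (x_fib M D hD Xs hX hXM)
  have hx0 : #({p ∈ Xs ×ˢ Xs | p.1 = p.2} ×ˢ T) ≤ #Xs * (#Ys * (Z ^ 2 * (2 * D)) +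
      #{x ∈ (Scl Ys H ×ˢ (Zs ×ˢ Zs)) ×ˢ (Zs ×ˢ Zs) | dk c x.1.1 + s5 x.1.2 = s5 x.2}) := by
    rw [card_product]
    exact Nat.mul_le_mul (hdiag Xs) hTb
  refine le_trans (le_trans (card_le_card ?_) (card_union_le _ _)) (Nat.add_le_add hx0 hx1)
  rintro ⟨⟨x1, x2⟩, b⟩ hx
  simp only [hT, mem_filter, mem_product, mem_union] at hx ⊢
  obtain ⟨⟨⟨h1, h2⟩, hb⟩, he⟩ := hx
  by_cases hxx : x1 = x2
  · left
    subst hxx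
    refine ⟨⟨⟨h1, h2⟩, rfl⟩, hb, ?_⟩
    have : dk 2 (x1, x1) = 0 := by simp [dk]
    linarith
  · right
    exact ⟨⟨⟨⟨h1, h2⟩, hxx⟩, hb⟩, he⟩

theorem final_real (x y z η D X Y Z H q K N : ℝ) (hX0 : 0 ≤ X) (hY0 : 0 ≤ Y)
    (hZ0 : 0 ≤ Z) (hH0 : 0 ≤ H) (hq0 : 0 ≤ q) (hK0 : 0 ≤ K) (hx : 0 < x) (hy : 0 < y)
    (hz : 1 ≤ z) (hη : 1 ≤ η) (hD : 1 ≤ D) (hX : X ≤ x) (hY : Y ≤ y) (hZ : Z ≤ z)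
    (hH : H ≤ 128 * η)
    (h1 : η ^ 2 ≤ y) (h2 : η ^ 3 * z ≤ y ^ 2) (h3 : y * z ^ 2 ≤ x)
    (hq : q ^ 2 ≤ (Y ^ 2 * (2 * H + 1) * (4 * D ^ 2)) *
        ((2 * Z + 1) * (4 * D * Z ^ 4 + 4 * D ^ 2 * Z ^ 4)))
    (hK : K ^ 2 ≤ ((2 * H + 1) * (Y * (2 * H + 1) * (Z ^ 2 * (2 * D)) + q)) * (Z ^ 2 * (2 * D)))
    (hN : N ≤ X * (Y * (Z ^ 2 * (2 * D)) + K) + Y ^ 2 * Z ^ 4 * D) :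
    N ≤ 603 * D ^ 2 * (x * y * z ^ 2) := by
  have hH1 : 2 * H + 1 ≤ 257 * η := by linarith
  have hZ1 : 2 * Z + 1 ≤ 3 * z := by linarith
  have hDD : D ≤ D ^ 2 := by nlinarith
  have hq2 : ((257 * η) * q) ^ 2 ≤ (41000 * D ^ 2 * (y ^ 2 * z ^ 2)) ^ 2 := by
    calc ((257 * η) * q) ^ 2 = 257 ^ 2 * η ^ 2 * q ^ 2 := by ring
      _ ≤ 257 ^ 2 * η ^ 2 * ((y ^ 2 * (257 * η) * (4 * D ^ 2)) *
          ((3 * z) * (4 * D ^ 2 * z ^ 4 + 4 * D ^ 2 * z ^ 4))) := by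
          gcongr
          refine hq.trans ?_
          gcongr
      _ = 1629560928 * D ^ 4 * y ^ 2 * z ^ 4 * (η ^ 3 * z) := by ring
      _ ≤ 1681000000 * D ^ 4 * y ^ 2 * z ^ 4 * (y ^ 2) := by gcongr; norm_num
      _ = _ := by ring
  have hq3 : (257 * η) * q ≤ 41000 * D ^ 2 * (y ^ 2 * z ^ 2) :=
    le_of_sq_le_sq hq2 (by positivity)
  have hK2 : K ^ 2 ≤ (600 * D ^ 2 * (y * z ^ 2)) ^ 2 := by
    calc K ^ 2 ≤ _ := hK
      _ ≤ ((257 * η) * (y * (257 * η) * (z ^ 2 * (2 * D)) + q)) * (z ^ 2 * (2 * D)) := by gcongr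
      _ = ((132098 * (y * D * z ^ 2)) * η ^ 2 + (257 * η) * q) * (z ^ 2 * (2 * D)) := by ring
      _ ≤ ((132098 * (y * D ^ 2 * z ^ 2)) * y + 41000 * D ^ 2 * (y ^ 2 * z ^ 2)) *
          (z ^ 2 * (2 * D ^ 2)) := by gcongr
      _ = 346196 * (D ^ 4 * (y ^ 2 * z ^ 4)) := by ring
      _ ≤ 360000 * (D ^ 4 * (y ^ 2 * z ^ 4)) := by gcongr; norm_num
      _ = _ := by ring
  have hK3 : K ≤ 600 * D ^ 2 * (y * z ^ 2) := le_of_sq_le_sq hK2 (by positivity)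
  calc N ≤ _ := hN
    _ ≤ x * (y * (z ^ 2 * (2 * D ^ 2)) + 600 * D ^ 2 * (y * z ^ 2)) + y ^ 2 * z ^ 4 * D ^ 2 := by
        gcongr
    _ = 602 * D ^ 2 * (x * y * z ^ 2) + (D ^ 2 * (y * z ^ 2)) * (y * z ^ 2) := by ring
    _ ≤ 602 * D ^ 2 * (x * y * z ^ 2) + (D ^ 2 * (y * z ^ 2)) * x := by gcongr
    _ = _ := by ring

theorem close_aux (c : ℕ) (hc : c = 6 ∨ c = 7) (a b y η z : ℝ) (hy : 0 < y) (hb : y / 2 < b)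
    (hab : b ≤ a) (hz : z ≤ η * y ^ (c - 1)) (h : a ^ c - b ^ c ≤ 2 * z) (hη : 0 ≤ η) :
    a - b ≤ 128 * η := by
  obtain ⟨k, rfl⟩ : ∃ k, c = k + 1 := ⟨c - 1, by omega⟩
  have hk : k ≤ 6 := by omega
  simp only [Nat.add_sub_cancel] at hz
  have hb0 : 0 < b := by linarith
  have h1 : b ^ k ≤ a ^ k := pow_le_pow_left₀ hb0.le hab k
  have h2 : (a - b) * b ^ k ≤ 2 * (η * y ^ k) := by
    have : a * b ^ k ≤ a ^ (k + 1) := by rw [pow_succ, mul_comm]; gcongr; linarith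
    rw [pow_succ b] at h
    nlinarith
  have h3 : (a - b) * (y / 2) ^ k ≤ 2 * (η * y ^ k) := by
    refine le_trans ?_ h2
    have : 0 ≤ a - b := by linarith
    gcongr
  have h4 : (2 : ℝ) ^ k ≤ 64 := by
    calc (2 : ℝ) ^ k ≤ 2 ^ 6 := pow_le_pow_right₀ (by norm_num) hk
      _ = 64 := by norm_num
  have hyk : 0 < y ^ k := by positivity
  rw [div_pow, ← mul_div_assoc, div_le_iff₀ (by positivity)] at h3
  have h5 : (a - b) * y ^ k ≤ (128 * η) * y ^ k := by
    refine h3.trans ?_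
    calc 2 * (η * y ^ k) * 2 ^ k ≤ 2 * (η * y ^ k) * 64 := by gcongr
      _ = _ := by ring
  exact le_of_mul_le_mul_right h5 hyk

set_option maxHeartbeats 2000000 in
/-- The number `N_c` of solutions of `x1² - x2² = y1^c - y2^c + z1⁵ + z2⁵ - z3⁵ - z4⁵`
with `P_2/2 < xᵢ ≤ P_2`, `P_c/2 < yᵢ ≤ P_c` and `1 ≤ z_j ≤ P_5^{θ_c}` satisfies
`N_c ≪ P_2^{1+ε} P_c P_5^{2θ_c}`. -/
theorem N_bound (c : ℕ) (hc : c = 6 ∨ c = 7) (ε : ℝ) (hε : 0 < ε) :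
    ∃ C : ℝ, 0 < C ∧ ∃ N : ℕ, ∀ n : ℕ, N ≤ n →
      (Nat.card {t : ℕ × ℕ × ℕ × ℕ × ℕ × ℕ × ℕ × ℕ //
          (P n 2 / 2 < (t.1 : ℝ) ∧ (t.1 : ℝ) ≤ P n 2) ∧
          (P n 2 / 2 < (t.2.1 : ℝ) ∧ (t.2.1 : ℝ) ≤ P n 2) ∧
          (P n c / 2 < (t.2.2.1 : ℝ) ∧ (t.2.2.1 : ℝ) ≤ P n c) ∧
          (P n c / 2 < (t.2.2.2.1 : ℝ) ∧ (t.2.2.2.1 : ℝ) ≤ P n c) ∧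
          (1 ≤ t.2.2.2.2.1 ∧ (t.2.2.2.2.1 : ℝ) ≤ P n 5 ^ θ c) ∧
          (1 ≤ t.2.2.2.2.2.1 ∧ (t.2.2.2.2.2.1 : ℝ) ≤ P n 5 ^ θ c) ∧
          (1 ≤ t.2.2.2.2.2.2.1 ∧ (t.2.2.2.2.2.2.1 : ℝ) ≤ P n 5 ^ θ c) ∧
          (1 ≤ t.2.2.2.2.2.2.2 ∧ (t.2.2.2.2.2.2.2 : ℝ) ≤ P n 5 ^ θ c) ∧
          (t.1 : ℤ) ^ 2 - (t.2.1 : ℤ) ^ 2 =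
            (t.2.2.1 : ℤ) ^ c - (t.2.2.2.1 : ℤ) ^ c
              + (t.2.2.2.2.1 : ℤ) ^ 5 + (t.2.2.2.2.2.1 : ℤ) ^ 5
              - (t.2.2.2.2.2.2.1 : ℤ) ^ 5 - (t.2.2.2.2.2.2.2 : ℤ) ^ 5} : ℝ) ≤
        C * P n 2 ^ (1 + ε) * P n c * P n 5 ^ (2 * θ c) := by
  classical
  obtain ⟨C, hC, hdiv⟩ := div_bound (ε / 4) (by positivity)
  refine ⟨603 * (C * 2 ^ (ε / 4)) ^ 2, by positivity, 1, fun n hn => ?_⟩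
  have hn1 : (1 : ℝ) ≤ n := by exact_mod_cast hn
  have hn0 : (0 : ℝ) < n := by linarith
  set ex : ℝ := if c = 6 then 0 else 3 / 98 with hex
  set η : ℝ := (n : ℝ) ^ ex with hηdef
  set x := P n 2 with hxdef
  set y := P n c with hydef
  set z := P n 5 ^ θ c with hzdef
  have hxe : x = (n : ℝ) ^ (1 / 2 : ℝ) := by rw [hxdef]; unfold P; norm_num
  have hye : y = (n : ℝ) ^ (1 / (c : ℝ)) := by rw [hydef]; unfold P; rw [one_div]
  have hze : z = (n : ℝ) ^ (θ c / 5) := by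
    rw [hzdef]; unfold P; rw [← Real.rpow_mul hn0.le]; congr 1; push_cast; ring
  have hx0 : 0 < x := by rw [hxe]; positivity
  have hy0 : 0 < y := by rw [hye]; positivity
  have hex0 : 0 ≤ ex := by rw [hex]; split_ifs <;> norm_num
  have hη1 : 1 ≤ η := Real.one_le_rpow hn1 hex0
  have hθ0 : 0 ≤ θ c := by unfold θ; split_ifs <;> norm_num
  have hz1 : 1 ≤ z := by rw [hze]; exact Real.one_le_rpow hn1 (by positivity)
  have hx2 : x ^ 2 = n := by
    rw [hxe, ← Real.rpow_natCast, ← Real.rpow_mul hn0.le]; norm_num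
  have hyc : y ^ c = n := by
    have : (c : ℝ) ≠ 0 := by rcases hc with rfl | rfl <;> norm_num
    rw [hye, ← Real.rpow_natCast, ← Real.rpow_mul hn0.le, one_div_mul_cancel this, Real.rpow_one]
  have hz5 : z ^ 5 ≤ n := by
    rw [hze, ← Real.rpow_natCast, ← Real.rpow_mul hn0.le]
    conv_rhs => rw [← Real.rpow_one (n : ℝ)]
    refine Real.rpow_le_rpow_of_exponent_le hn1 ?_
    unfold θ; split_ifs <;> norm_num
  have a1 : η ^ 2 ≤ y := by
    rw [hηdef, hye, ← Real.rpow_natCast, ← Real.rpow_mul hn0.le]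
    refine Real.rpow_le_rpow_of_exponent_le hn1 ?_
    rw [hex]; rcases hc with rfl | rfl <;> norm_num
  have a2 : η ^ 3 * z ≤ y ^ 2 := by
    rw [hηdef, hye, hze, ← Real.rpow_natCast, ← Real.rpow_natCast, ← Real.rpow_mul hn0.le,
      ← Real.rpow_mul hn0.le, ← Real.rpow_add hn0]
    refine Real.rpow_le_rpow_of_exponent_le hn1 ?_
    rw [hex]; unfold θ; rcases hc with rfl | rfl <;> norm_num
  have a3 : y * z ^ 2 ≤ x := by
    rw [hxe, hye, hze, ← Real.rpow_natCast, ← Real.rpow_mul hn0.le, ← Real.rpow_add hn0]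
    refine Real.rpow_le_rpow_of_exponent_le hn1 ?_
    unfold θ; rcases hc with rfl | rfl <;> norm_num
  have a4 : z ^ 5 ≤ η * y ^ (c - 1) := by
    rw [hηdef, hye, hze, ← Real.rpow_natCast, ← Real.rpow_natCast, ← Real.rpow_mul hn0.le,
      ← Real.rpow_mul hn0.le, ← Real.rpow_add hn0]
    refine Real.rpow_le_rpow_of_exponent_le hn1 ?_
    rw [hex]; unfold θ; rcases hc with rfl | rfl <;> norm_num
  -- the divisor bound
  set D : ℕ := ⌊C * ((2 * n : ℕ) : ℝ) ^ (ε / 4)⌋₊ with hDdef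
  have hD : ∀ m : ℕ, 0 < m → m ≤ 2 * n → #m.divisors ≤ D := by
    intro m hm hmn
    refine Nat.le_floor ((hdiv m hm).trans ?_)
    gcongr
  have hD1 : 1 ≤ D := by simpa using hD 1 one_pos (by omega)
  have hDle : (D : ℝ) ≤ C * 2 ^ (ε / 4) * (n : ℝ) ^ (ε / 4) := by
    refine (Nat.floor_le (by positivity)).trans ?_
    push_cast
    rw [Real.mul_rpow (by norm_num) hn0.le, mul_assoc]
  set Z : ℕ := ⌊z⌋₊ with hZdef
  have hZz : (Z : ℝ) ≤ z := Nat.floor_le (by linarith)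
  set H : ℕ := ⌊128 * η⌋₊ with hHdef
  have hHη : (H : ℝ) ≤ 128 * η := Nat.floor_le (by linarith)
  set Xs : Finset ℤ := Icc 1 (⌊x⌋₊ : ℤ) with hXs
  set Ys : Finset ℤ := {a ∈ Icc 1 (⌊y⌋₊ : ℤ) | y / 2 < (a : ℝ)} with hYs
  have cX : (#Xs : ℝ) ≤ x := by
    rw [hXs]; simp only [Int.card_Icc, add_sub_cancel_right, Int.toNat_natCast]
    exact Nat.floor_le hx0.le
  have cY : (#Ys : ℝ) ≤ y := by
    have : #Ys ≤ ⌊y⌋₊ := by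
      refine (card_filter_le _ _).trans ?_
      simp
    exact le_trans (by exact_mod_cast this) (Nat.floor_le hy0.le)
  have hYprop : ∀ a ∈ Ys, 0 < a ∧ (a : ℝ) ≤ y ∧ y / 2 < (a : ℝ) := by
    intro a ha
    rw [hYs, mem_filter, mem_Icc] at ha
    refine ⟨by omega, ?_, ha.2⟩
    have h1 : (a : ℝ) ≤ ((⌊y⌋₊ : ℤ) : ℝ) := by exact_mod_cast ha.1.2
    have h2 := Nat.floor_le hy0.le
    push_cast at h1
    linarith
  have hZ5 : (Z : ℝ) ^ 5 ≤ z ^ 5 := by gcongr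
  have hM : 2 * Z ^ 5 ≤ 2 * n := by
    have : (Z : ℝ) ^ 5 ≤ n := hZ5.trans hz5
    have : Z ^ 5 ≤ n := by exact_mod_cast this
    omega
  have hYM : ∀ a ∈ Ys, 2 * a ^ c ≤ ((2 * n : ℕ) : ℤ) := by
    intro a ha
    obtain ⟨h1, h2, -⟩ := hYprop a ha
    have : (a : ℝ) ^ c ≤ n := by
      rw [← hyc]
      exact pow_le_pow_left₀ (by exact_mod_cast h1.le) h2 c
    have : a ^ c ≤ (n : ℤ) := by exact_mod_cast this
    push_cast
    linarith
  have hXp : ∀ a ∈ Xs, 0 < a := by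
    intro a ha; rw [hXs, mem_Icc] at ha; omega
  have hXM : ∀ a ∈ Xs, a ^ 2 ≤ ((2 * n : ℕ) : ℤ) := by
    intro a ha
    have hp := hXp a ha
    rw [hXs, mem_Icc] at ha
    have h1 : (a : ℝ) ≤ ((⌊x⌋₊ : ℤ) : ℝ) := by exact_mod_cast ha.2
    have h2 := Nat.floor_le hx0.le
    push_cast at h1
    have : (a : ℝ) ^ 2 ≤ n := by
      rw [← hx2]
      exact pow_le_pow_left₀ (by exact_mod_cast hp.le) (by linarith) 2
    have : a ^ 2 ≤ (n : ℤ) := by exact_mod_cast this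
    push_cast
    linarith
  have hhalf : ∀ a ∈ Ys, ∀ b ∈ Ys, b ≤ a → |a ^ c - b ^ c| ≤ 2 * (Z : ℤ) ^ 5 → a - b ≤ H := by
    intro a ha b hb hab h
    have h1 : ((a ^ c - b ^ c : ℤ) : ℝ) ≤ ((2 * (Z : ℤ) ^ 5 : ℤ) : ℝ) := by
      exact_mod_cast (le_abs_self _).trans h
    push_cast at h1
    have h2 := close_aux c hc a b y η (z ^ 5) hy0 (hYprop b hb).2.2 (by exact_mod_cast hab) a4
      (by linarith) (by linarith)
    have h3 : ((a - b).toNat : ℝ) ≤ 128 * η := by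
      have : (((a - b).toNat : ℤ) : ℝ) = ((a - b : ℤ) : ℝ) := by
        rw [Int.toNat_of_nonneg (by omega)]
      have h4 : ((a - b).toNat : ℝ) = (a : ℝ) - b := by
        push_cast at this
        exact_mod_cast this
      rw [h4]; exact h2
    have h5 := Nat.le_floor h3
    omega
  have hYH : ∀ a ∈ Ys, ∀ b ∈ Ys, |a ^ c - b ^ c| ≤ 2 * (Z : ℤ) ^ 5 → |a - b| ≤ H := by
    intro a ha b hb h
    rcases le_total b a with hab | hab
    · rw [abs_of_nonneg (by omega)]
      exact hhalf a ha b hb hab h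
    · rw [abs_sub_comm, abs_of_nonneg (by omega)]
      exact hhalf b hb a ha hab (by rwa [abs_sub_comm])
  obtain ⟨q, K, hq, hK, hN⟩ := N_comb (2 * n) D hD Z H c hc hM Ys (fun a ha => (hYprop a ha).1)
    hYM hYH Xs hXp hXM
  set W := {w ∈ (Xs ×ˢ Xs) ×ˢ (((Ys ×ˢ Ys) ×ˢ (Icc 1 (Z : ℤ) ×ˢ Icc 1 (Z : ℤ))) ×ˢ
          (Icc 1 (Z : ℤ) ×ˢ Icc 1 (Z : ℤ))) |
          dk 2 w.1 = dk c w.2.1.1 + s5 w.2.1.2 - s5 w.2.2} with hW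
  have memX : ∀ t : ℕ, (x / 2 < (t : ℝ) ∧ (t : ℝ) ≤ x) → (t : ℤ) ∈ Xs := by
    rintro t ⟨h1, h2⟩
    have h3 : t ≤ ⌊x⌋₊ := Nat.le_floor h2
    have h4 : (0 : ℝ) < t := by linarith
    have h5 : 0 < t := by exact_mod_cast h4
    rw [hXs, mem_Icc]
    omega
  have memY : ∀ t : ℕ, (y / 2 < (t : ℝ) ∧ (t : ℝ) ≤ y) → (t : ℤ) ∈ Ys := by
    rintro t ⟨h1, h2⟩
    have h3 : t ≤ ⌊y⌋₊ := Nat.le_floor h2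
    have h4 : (0 : ℝ) < t := by linarith
    have h5 : 0 < t := by exact_mod_cast h4
    rw [hYs, mem_filter, mem_Icc]
    refine ⟨by omega, ?_⟩
    push_cast
    exact h1
  have memZ : ∀ t : ℕ, (1 ≤ t ∧ (t : ℝ) ≤ z) → (t : ℤ) ∈ Icc 1 (Z : ℤ) := by
    rintro t ⟨h1, h2⟩
    have h3 : t ≤ Z := Nat.le_floor h2
    rw [mem_Icc]
    omega
  have hcard : Nat.card {t : ℕ × ℕ × ℕ × ℕ × ℕ × ℕ × ℕ × ℕ //
          (x / 2 < (t.1 : ℝ) ∧ (t.1 : ℝ) ≤ x) ∧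
          (x / 2 < (t.2.1 : ℝ) ∧ (t.2.1 : ℝ) ≤ x) ∧
          (y / 2 < (t.2.2.1 : ℝ) ∧ (t.2.2.1 : ℝ) ≤ y) ∧
          (y / 2 < (t.2.2.2.1 : ℝ) ∧ (t.2.2.2.1 : ℝ) ≤ y) ∧
          (1 ≤ t.2.2.2.2.1 ∧ (t.2.2.2.2.1 : ℝ) ≤ z) ∧
          (1 ≤ t.2.2.2.2.2.1 ∧ (t.2.2.2.2.2.1 : ℝ) ≤ z) ∧
          (1 ≤ t.2.2.2.2.2.2.1 ∧ (t.2.2.2.2.2.2.1 : ℝ) ≤ z) ∧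
          (1 ≤ t.2.2.2.2.2.2.2 ∧ (t.2.2.2.2.2.2.2 : ℝ) ≤ z) ∧
          (t.1 : ℤ) ^ 2 - (t.2.1 : ℤ) ^ 2 =
            (t.2.2.1 : ℤ) ^ c - (t.2.2.2.1 : ℤ) ^ c
              + (t.2.2.2.2.1 : ℤ) ^ 5 + (t.2.2.2.2.2.1 : ℤ) ^ 5
              - (t.2.2.2.2.2.2.1 : ℤ) ^ 5 - (t.2.2.2.2.2.2.2 : ℤ) ^ 5} ≤ #W := by
    rw [← Nat.card_eq_finsetCard W]
    refine Nat.card_le_card_of_injective (fun t => ⟨(((t.1.1 : ℤ), (t.1.2.1 : ℤ)),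
      ((((t.1.2.2.1 : ℤ), (t.1.2.2.2.1 : ℤ)), ((t.1.2.2.2.2.1 : ℤ), (t.1.2.2.2.2.2.1 : ℤ))),
        ((t.1.2.2.2.2.2.2.1 : ℤ), (t.1.2.2.2.2.2.2.2 : ℤ)))), ?_⟩) ?_
    · obtain ⟨⟨x1, x2, y1, y2, z1, z2, z3, z4⟩, h1, h2, h3, h4, h5, h6, h7, h8, h9⟩ := t
      rw [hW, mem_filter]
      simp only [mem_product]
      refine ⟨⟨⟨memX _ h1, memX _ h2⟩, ⟨⟨memY _ h3, memY _ h4⟩, memZ _ h5, memZ _ h6⟩,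
        memZ _ h7, memZ _ h8⟩, ?_⟩
      simp only at h9
      simp only [dk, s5]
      linarith
    · rintro ⟨⟨x1, x2, y1, y2, z1, z2, z3, z4⟩, h⟩ ⟨⟨x1', x2', y1', y2', z1', z2', z3', z4'⟩, h'⟩ he
      simp only [Subtype.mk.injEq, Prod.mk.injEq, Nat.cast_inj] at he ⊢
      tauto
  have hfin := final_real x y z η D #Xs #Ys Z H q K #W (Nat.cast_nonneg _)
    (Nat.cast_nonneg _) (Nat.cast_nonneg _) (Nat.cast_nonneg _) (Nat.cast_nonneg _)
    (Nat.cast_nonneg _) hx0 hy0 hz1 hη1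
    (by exact_mod_cast hD1) cX cY hZz hHη a1 a2 a3 (by exact_mod_cast hq) (by exact_mod_cast hK)
    (by exact_mod_cast hN)
  refine le_trans (by exact_mod_cast hcard) (hfin.trans ?_)
  have hz2 : P n 5 ^ (2 * θ c) = z ^ 2 := by
    have : 0 ≤ P n 5 := by unfold P; positivity
    rw [hzdef, ← Real.rpow_natCast, ← Real.rpow_mul this]; congr 1; push_cast; ring
  have hxε : x ^ (1 + ε) = x * ((n : ℝ) ^ (ε / 4)) ^ 2 := by
    rw [Real.rpow_add hx0, Real.rpow_one]
    congr 1
    rw [hxe, ← Real.rpow_natCast, ← Real.rpow_mul hn0.le, ← Real.rpow_mul hn0.le]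
    congr 1; push_cast; ring
  rw [hz2, hxε]
  calc 603 * (D : ℝ) ^ 2 * (x * y * z ^ 2)
      ≤ 603 * (C * 2 ^ (ε / 4) * (n : ℝ) ^ (ε / 4)) ^ 2 * (x * y * z ^ 2) := by gcongr
    _ = _ := by ring
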